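/- arXiv:1207.3674 — 3 statements merged into one kernel-verified Lean document; each statement's English description precedes it below -/
import Mathlib

section
/- Every persistence module over a finite subset T ⊆ ℝ (equivalently, every finite diagram V_1 → V_2 → ⋯ → V_n of k-vector spaces and linear maps, with no finite-dimensionality assumption on the spaces) is isomorphic to a direct sum of interval modules. -/
attribute [local instance] Classical.propDecidable

structure PersMod (k : Type) [Field k] (T : Type) [Preorder T] where
  space : T → Type
  [addCommGroup : ∀ t, AddCommGroup (space t)]
  [module : ∀ t, Module k (space t)]
  map : ∀ s t : T, s ≤ t → space s →ₗ[k] space t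
  map_id : ∀ t, map t t le_rfl = LinearMap.id
  map_comp : ∀ r s t (h1 : r ≤ s) (h2 : s ≤ t),
    (map s t h2).comp (map r s h1) = map r t (h1.trans h2)

attribute [instance] PersMod.addCommGroup PersMod.module

def PersIso {k : Type} [Field k] {T : Type} [Preorder T] (U V : PersMod k T) : Prop :=
  ∃ e : ∀ t, U.space t ≃ₗ[k] V.space t,
    ∀ s t (h : s ≤ t),
      (e t).toLinearMap.comp (U.map s t h) = (V.map s t h).comp (e s).toLinearMap

def IsIntervalSet {T : Type} [Preorder T] (J : Set T) : Prop :=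
  J.Nonempty ∧ ∀ ⦃r s t : T⦄, r ∈ J → t ∈ J → r ≤ s → s ≤ t → s ∈ J

noncomputable def intervalModule (k : Type) [Field k] (T : Type) [Preorder T]
    (J : Set T) (hJ : IsIntervalSet J) : PersMod k T where
  space t := PLift (t ∈ J) → k
  addCommGroup := fun _ => inferInstance
  module := fun _ => inferInstance
  map s t _ :=
    { toFun := fun f _ => if hs : s ∈ J then f ⟨hs⟩ else 0
      map_add' := fun f g => by
        funext ht; by_cases hs : s ∈ J <;> simp [hs]
      map_smul' := fun c f => by
        funext ht; by_cases hs : s ∈ J <;> simp [hs] }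
  map_id t := by
    refine LinearMap.ext fun f => funext fun ht => ?_
    show (if hs : t ∈ J then f ⟨hs⟩ else 0) = f ht
    rw [dif_pos ht.down]
  map_comp r s t h1 h2 := by
    refine LinearMap.ext fun f => funext fun ht => ?_
    show (if hs : s ∈ J then (if hr : r ∈ J then f ⟨hr⟩ else 0) else 0)
        = (if hr : r ∈ J then f ⟨hr⟩ else 0)
    by_cases hr : r ∈ J
    · have hs : s ∈ J := hJ.2 hr ht.down h1 h2
      simp [hr, hs]
    · by_cases hs : s ∈ J <;> simp [hr, hs]

noncomputable def dsum {k : Type} [Field k] {T : Type} [Preorder T] {L : Type}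
    (V : L → PersMod k T) : PersMod k T where
  space t := DFinsupp (fun ℓ => (V ℓ).space t)
  addCommGroup := fun _ => inferInstance
  module := fun _ => inferInstance
  map s t h := DFinsupp.mapRange.linearMap (fun ℓ => (V ℓ).map s t h)
  map_id t := by
    show DFinsupp.mapRange.linearMap (fun ℓ => (V ℓ).map t t le_rfl) = LinearMap.id
    have : (fun ℓ => (V ℓ).map t t le_rfl)
        = fun ℓ => (LinearMap.id : (V ℓ).space t →ₗ[k] (V ℓ).space t) :=
      funext fun ℓ => (V ℓ).map_id t
    rw [this]
    exact DFinsupp.mapRange.linearMap_id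
  map_comp r s t h1 h2 := by
    show (DFinsupp.mapRange.linearMap (fun ℓ => (V ℓ).map s t h2)).comp
        (DFinsupp.mapRange.linearMap (fun ℓ => (V ℓ).map r s h1))
      = DFinsupp.mapRange.linearMap (fun ℓ => (V ℓ).map r t (h1.trans h2))
    rw [← DFinsupp.mapRange.linearMap_comp]
    congr 1
    funext ℓ
    exact (V ℓ).map_comp r s t h1 h2

open scoped ENNReal

section Dim

noncomputable def edim (k : Type) [Field k] (M : Type) [AddCommGroup M] [Module k M] : ℕ∞ :=
  Cardinal.toENat (Module.rank k M)

noncomputable def erank {k : Type} [Field k] {M N : Type} [AddCommGroup M] [Module k M]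
    [AddCommGroup N] [Module k N] (f : M →ₗ[k] N) : ℕ∞ :=
  edim k (LinearMap.range f)

noncomputable def ecard (S : Type) : ℕ∞ := Cardinal.toENat (Cardinal.mk S)

end Dim

section Matchings

noncomputable def eDiff (x y : EReal) : ℝ≥0∞ :=
  if x = y then 0
  else if x = ⊤ ∨ x = ⊥ ∨ y = ⊤ ∨ y = ⊥ then ⊤
  else ENNReal.ofReal |x.toReal - y.toReal|

noncomputable def dPt (α β : EReal × EReal) : ℝ≥0∞ :=
  max (eDiff α.1 β.1) (eDiff α.2 β.2)

noncomputable def diagDist (α : EReal × EReal) : ℝ≥0∞ :=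
  if α.1 = ⊥ ∨ α.2 = ⊤ then ⊤ else ENNReal.ofReal ((α.2.toReal - α.1.toReal) / 2)

def IsMatching {α β : Type} (M : Set (α × β)) : Prop :=
  (∀ a b b', (a, b) ∈ M → (a, b') ∈ M → b = b') ∧
  (∀ a a' b, (a, b) ∈ M → (a', b) ∈ M → a = a')

def IsDeltaMatching {α β : Type} (A : α → EReal × EReal) (B : β → EReal × EReal)
    (δ : ℝ≥0∞) : Prop :=
  ∃ M : Set (α × β), IsMatching M ∧
    (∀ p ∈ M, dPt (A p.1) (B p.2) ≤ δ) ∧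
    (∀ a, (∀ b, (a, b) ∉ M) → diagDist (A a) ≤ δ) ∧
    (∀ b, (∀ a, (a, b) ∉ M) → diagDist (B b) ≤ δ)

noncomputable def dBottle {α β : Type} (A : α → EReal × EReal) (B : β → EReal × EReal) : ℝ≥0∞ :=
  sInf {d : ℝ≥0∞ | ∃ δ : ℝ, 0 ≤ δ ∧ IsDeltaMatching A B (ENNReal.ofReal δ) ∧ d = ENNReal.ofReal δ}

end Matchings

section Measure

noncomputable def persIm {k : Type} [Field k] (V : PersMod k ℝ) (a : EReal) (c : ℝ) :
    Submodule k (V.space c) :=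
  if h : ∃ a' : ℝ, a = (a' : EReal) ∧ a' ≤ c then
    LinearMap.range (V.map h.choose c h.choose_spec.2)
  else ⊥

noncomputable def persKer {k : Type} [Field k] (V : PersMod k ℝ) (c : ℝ) (d : EReal) :
    Submodule k (V.space c) :=
  if h : ∃ d' : ℝ, d = (d' : EReal) ∧ c ≤ d' then
    LinearMap.ker (V.map c h.choose h.choose_spec.2)
  else ⊤

noncomputable def persMeasure {k : Type} [Field k] (V : PersMod k ℝ)
    (a : EReal) (b c : ℝ) (d : EReal) : ℕ∞ :=
  edim k
    (↥(persIm V (b : EReal) c ⊓ persKer V c d) ⧸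
      Submodule.comap (persIm V (b : EReal) c ⊓ persKer V c d).subtype
        (persIm V a c ⊓ persKer V c d))

end Measure

section Interleaving

def Interleaved (k : Type) [Field k] (U V : PersMod k ℝ) (δ : ℝ) : Prop :=
  ∃ (φ : ∀ t : ℝ, U.space t →ₗ[k] V.space (t + δ))
    (ψ : ∀ t : ℝ, V.space t →ₗ[k] U.space (t + δ)),
    (∀ s t (h : s ≤ t),
      (φ t).comp (U.map s t h) = (V.map (s + δ) (t + δ) (by linarith)).comp (φ s)) ∧
    (∀ s t (h : s ≤ t),
      (ψ t).comp (V.map s t h) = (U.map (s + δ) (t + δ) (by linarith)).comp (ψ s)) ∧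
    (∀ t (h : t ≤ t + δ + δ), (ψ (t + δ)).comp (φ t) = U.map t (t + δ + δ) h) ∧
    (∀ t (h : t ≤ t + δ + δ), (φ (t + δ)).comp (ψ t) = V.map t (t + δ + δ) h)

noncomputable def dInter (k : Type) [Field k] (U V : PersMod k ℝ) : ℝ≥0∞ :=
  sInf {d : ℝ≥0∞ | ∃ δ : ℝ, 0 ≤ δ ∧ Interleaved k U V δ ∧ d = ENNReal.ofReal δ}

def QTame (k : Type) [Field k] (V : PersMod k ℝ) : Prop :=
  ∀ s t : ℝ, ∀ h : s < t, erank (V.map s t h.le) ≠ ⊤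

def LocFinitePM (k : Type) [Field k] (W : PersMod k ℝ) : Prop :=
  ∃ (L : Type) (J : L → Set ℝ) (hJ : ∀ ℓ, IsIntervalSet (J ℓ)),
    PersIso W (dsum fun ℓ => intervalModule k ℝ (J ℓ) (hJ ℓ)) ∧
    ∀ S : Set ℝ, Bornology.IsBounded S → {ℓ : L | (J ℓ ∩ S).Nonempty}.Finite

noncomputable def zeroPers (k : Type) [Field k] : PersMod k ℝ where
  space _ := PUnit
  addCommGroup := fun _ => inferInstance
  module := fun _ => inferInstance
  map _ _ _ := 0
  map_id t := LinearMap.ext fun x => Subsingleton.elim _ _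
  map_comp r s t h1 h2 := LinearMap.ext fun x => Subsingleton.elim _ _

noncomputable def smoothing {k : Type} [Field k] (V : PersMod k ℝ) (ε : ℝ) (hε : 0 < ε) :
    PersMod k ℝ where
  space t := LinearMap.range (V.map (t - ε) (t + ε) (by linarith))
  addCommGroup := fun _ => inferInstance
  module := fun _ => inferInstance
  map s t h := LinearMap.restrict (V.map (s + ε) (t + ε) (by linarith))
    (p := LinearMap.range (V.map (s - ε) (s + ε) (by linarith)))
    (q := LinearMap.range (V.map (t - ε) (t + ε) (by linarith)))
    (by
      rintro x ⟨y, rfl⟩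
      refine ⟨V.map (s - ε) (t - ε) (by linarith) y, ?_⟩
      have h1 := LinearMap.congr_fun
        (V.map_comp (s - ε) (t - ε) (t + ε) (by linarith) (by linarith)) y
      have h2 := LinearMap.congr_fun
        (V.map_comp (s - ε) (s + ε) (t + ε) (by linarith) (by linarith)) y
      simp only [LinearMap.comp_apply] at h1 h2
      rw [h1, h2])
  map_id t := by
    refine LinearMap.ext fun x => Subtype.ext ?_
    have := LinearMap.congr_fun (V.map_id (t + ε)) x.1
    simpa [LinearMap.restrict_apply] using this
  map_comp r s t h1 h2 := by
    refine LinearMap.ext fun x => Subtype.ext ?_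
    have := LinearMap.congr_fun
      (V.map_comp (r + ε) (s + ε) (t + ε) (by linarith) (by linarith)) x.1
    simpa [LinearMap.restrict_apply] using this

end Interleaving

section Webb

def webbSubmodule (k : Type) [Field k] (t : ℤ) : Submodule k (ℕ → k) where
  carrier := {x | ∀ i : ℕ, (i : ℤ) < -t → x i = 0}
  add_mem' := by
    intro x y hx hy i hi
    simp [Pi.add_apply, hx i hi, hy i hi]
  zero_mem' := by
    intro i hi
    rfl
  smul_mem' := by
    intro c x hx i hi
    simp [Pi.smul_apply, hx i hi]

noncomputable def webbModule (k : Type) [Field k] : PersMod k ↥{n : ℤ | n ≤ 0} where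
  space t := ↥(webbSubmodule k t.1)
  addCommGroup := fun _ => inferInstance
  module := fun _ => inferInstance
  map s t h := Submodule.inclusion (by
    intro x hx
    have hx' : ∀ i : ℕ, (i : ℤ) < -s.1 → x i = 0 := hx
    intro i hi
    exact hx' i (lt_of_lt_of_le hi (neg_le_neg h)))
  map_id t := LinearMap.ext fun x => rfl
  map_comp r s t h1 h2 := LinearMap.ext fun x => rfl

end Webb

section Decorated

/-- `decMem t x` : the real number `t` belongs to the interval described by the
decorated pair `x = ((p, εp), (q, εq))`, where the decoration `false` means `⁻`
and `true` means `⁺`. -/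
def decMem (t : ℝ) (x : (EReal × Bool) × (EReal × Bool)) : Prop :=
  (x.1.1 < (t : EReal) ∨ (x.1.1 = (t : EReal) ∧ x.1.2 = false)) ∧
  ((t : EReal) < x.2.1 ∨ ((t : EReal) = x.2.1 ∧ x.2.2 = true))

/-- A valid decorated pair: the left coordinate is `p⁻`/`p⁺` for a real `p` or `−∞⁺`,
the right coordinate is `q⁻`/`q⁺` for a real `q` or `+∞⁻`, and the corresponding
interval is nonempty (i.e. `p* < q*`). -/
def ValidDec (x : (EReal × Bool) × (EReal × Bool)) : Prop :=
  (x.1.1 = ⊥ → x.1.2 = true) ∧ x.1.1 ≠ ⊤ ∧ (x.2.1 = ⊤ → x.2.2 = false) ∧ x.2.1 ≠ ⊥ ∧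
  {t : ℝ | decMem t x}.Nonempty

/-- The decorated pair `x` belongs to the rectangle `[a,b] × [c,d]`, i.e.
`[b,c] ⊆ ⟨p*,q*⟩ ⊆ (a,d)`. -/
def decInRect (x : (EReal × Bool) × (EReal × Bool)) (a : EReal) (b c : ℝ) (d : EReal) : Prop :=
  (∀ t ∈ Set.Icc b c, decMem t x) ∧
  (∀ t : ℝ, decMem t x → a < (t : EReal) ∧ (t : EReal) < d)

/-- `Dgm` is (a labelling of) the decorated persistence diagram of `V`. -/
def IsDgmOf {k : Type} [Field k] (V : PersMod k ℝ) {ι : Type}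
    (Dgm : ι → (EReal × Bool) × (EReal × Bool)) : Prop :=
  (∀ i, ValidDec (Dgm i)) ∧
  ∀ (a : EReal) (b c : ℝ) (d : EReal), a < (b : EReal) → b ≤ c → (c : EReal) < d →
    persMeasure V a b c d = ecard {i : ι // decInRect (Dgm i) a b c d}

end Decorated

section RMeasure

/-- `[a,b] × [c,d]` is a (nondegenerate) rectangle contained in `D`. -/
def RectIn (D : Set (ℝ × ℝ)) (a b c d : ℝ) : Prop :=
  a < b ∧ c < d ∧ Set.Icc a b ×ˢ Set.Icc c d ⊆ D

/-- An r-measure on `D`: additivity under horizontal and vertical splitting. -/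
def IsRMeasure (D : Set (ℝ × ℝ)) (μ : ℝ → ℝ → ℝ → ℝ → ℕ∞) : Prop :=
  (∀ a p b c d, a < p → p < b → RectIn D a b c d → μ a b c d = μ a p c d + μ p b c d) ∧
  (∀ a b c q d, c < q → q < d → RectIn D a b c d → μ a b c d = μ a b c q + μ a b q d)

/-- Membership of a decorated point of the plane (`Bool` decoration: `true` = `⁺`,
`false` = `⁻`) in the closed rectangle `[a,b] × [c,d]`. -/
def dptMem (x : (ℝ × Bool) × (ℝ × Bool)) (a b c d : ℝ) : Prop :=
  a ≤ x.1.1 ∧ x.1.1 ≤ b ∧ c ≤ x.2.1 ∧ x.2.1 ≤ d ∧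
  (x.1.1 = a → x.1.2 = true) ∧ (x.1.1 = b → x.1.2 = false) ∧
  (x.2.1 = c → x.2.2 = true) ∧ (x.2.1 = d → x.2.2 = false)

/-- The r-interior `D•` of `D`: decorated points contained in some rectangle of `D`. -/
def rInt (D : Set (ℝ × ℝ)) : Set ((ℝ × Bool) × (ℝ × Bool)) :=
  {x | ∃ a b c d, RectIn D a b c d ∧ dptMem x a b c d}

/-- The number of decorated points, counted with multiplicity `m`, lying in the
rectangle `[a,b] × [c,d]`. -/
noncomputable def dcount (m : (ℝ × Bool) × (ℝ × Bool) → ℕ) (a b c d : ℝ) : ℕ∞ :=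
  ecard (Σ x : {x : (ℝ × Bool) × (ℝ × Bool) // dptMem x a b c d}, Fin (m x.1))

end RMeasure

theorem exists_adapted_sets {k M : Type} [Field k] [AddCommGroup M] [Module k M]
    (F : ℕ → Submodule k M) (hF : Monotone F) :
    ∃ S : ℕ → Set M, Monotone S ∧ (∀ n, LinearIndepOn k id (S n)) ∧
      ∀ n, Submodule.span k (S n) = F n := by
  have key : ∀ (G : Submodule k M) (s : Set M), LinearIndepOn k id s → s ⊆ G →
      ∃ b : Set M, s ⊆ b ∧ LinearIndepOn k id b ∧ Submodule.span k b = G := by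
    intro G s hs hsG
    obtain ⟨b, hb, hsb, hGb, hli⟩ := exists_linearIndepOn_id_extension hs hsG
    exact ⟨b, hsb, hli, le_antisymm (Submodule.span_le.2 hb) hGb⟩
  have h0 := key (F 0) ∅ (linearIndepOn_empty k id) (by simp)
  let S : ∀ n, {s : Set M // LinearIndepOn k id s ∧ Submodule.span k s = F n} := fun n =>
    Nat.rec (motive := fun n => {s : Set M // LinearIndepOn k id s ∧ Submodule.span k s = F n})
      ⟨h0.choose, h0.choose_spec.2⟩
      (fun n s =>
        have h := key (F (n+1)) s.1 s.2.1
          (Submodule.subset_span.trans (s.2.2.le.trans (hF n.le_succ)))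
        ⟨h.choose, h.choose_spec.2⟩) n
  refine ⟨fun n => (S n).1, monotone_nat_of_le_succ fun n => ?_, fun n => (S n).2.1,
    fun n => (S n).2.2⟩
  exact (key (F (n+1)) (S n).1 (S n).2.1
          (Submodule.subset_span.trans ((S n).2.2.le.trans (hF n.le_succ)))).choose_spec.1

theorem exists_adapted_lift {k M : Type} [Field k] [AddCommGroup M] [Module k M]
    (R : Submodule k M) (F : ℕ → Submodule k M) (hF : Monotone F) (N : ℕ) (hN : F N = ⊤) :
    ∃ (ι : Type) (l : ι → M) (d : ι → ℕ), (∀ i, l i ∈ F (d i)) ∧ (∀ i, l i ≠ 0) ∧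
      (R ⊔ Submodule.span k (Set.range l) = ⊤) ∧
      ∀ (n : ℕ) (c : ι →₀ k), Finsupp.linearCombination k l c ∈ R ⊔ F n →
        ∀ i, n < d i → c i = 0 := by
  obtain ⟨S, hS, hli, hsp⟩ := exists_adapted_sets (fun n => (F n).map R.mkQ)
    (fun a b h => Submodule.map_mono (hF h))
  have hne : ∀ x : S N, ∃ n, x.1 ∈ S n := fun x => ⟨N, x.2⟩
  let d : S N → ℕ := fun x => sInf {n | x.1 ∈ S n}
  have hd : ∀ x : S N, x.1 ∈ S (d x) := fun x => Nat.sInf_mem (hne x)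
  have hlift : ∀ x : S N, ∃ y ∈ F (d x), R.mkQ y = x.1 := by
    intro x
    have : x.1 ∈ (F (d x)).map R.mkQ := by
      rw [← hsp]; exact Submodule.subset_span (hd x)
    exact this
  choose l hl1 hl2 using hlift
  refine ⟨S N, l, d, hl1, ?_, ?_, ?_⟩
  · intro x hx
    have h1 := hl2 x
    rw [hx, map_zero] at h1
    exact (hli N).ne_zero x.2 h1.symm
  · rw [eq_top_iff]
    have h1 : (Submodule.span k (Set.range l)).map R.mkQ = ⊤ := by
      rw [Submodule.map_span, ← Set.range_comp]
      have : (R.mkQ ∘ l) = (Subtype.val : S N → _) := funext hl2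
      rw [this, Subtype.range_coe, hsp, hN, Submodule.map_top, Submodule.range_mkQ]
    intro y _
    have h2 : R.mkQ y ∈ (Submodule.span k (Set.range l)).map R.mkQ := by rw [h1]; trivial
    obtain ⟨z, hz, hzy⟩ := h2
    have h3 : y - z ∈ R := by
      rw [← Submodule.Quotient.mk_eq_zero, Submodule.Quotient.mk_sub, sub_eq_zero]
      exact hzy.symm
    have : y = (y - z) + z := by abel
    rw [this]
    exact Submodule.add_mem_sup h3 hz
  · intro n c hc i hi
    have hin : i.1 ∉ S n := fun h => absurd (Nat.sInf_le h : d i ≤ n) (not_le.2 hi)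
    have h1 : R.mkQ (Finsupp.linearCombination k l c) ∈ Submodule.span k (S n) := by
      rw [hsp]
      have := Submodule.mem_map_of_mem (f := R.mkQ) hc
      rw [Submodule.map_sup, Submodule.mkQ_map_self, bot_sup_eq] at this
      exact this
    rw [Finsupp.apply_linearCombination] at h1
    have h2 : (R.mkQ ∘ l) = (Subtype.val : S N → _) := funext hl2
    rw [h2] at h1
    have hli' : LinearIndependent k (Subtype.val : S N → M ⧸ R) := hli N
    by_cases hnN : n ≤ N
    · have h3 : S n = (Subtype.val : S N → M ⧸ R) '' {x | x.1 ∈ S n} := by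
        ext x; constructor
        · intro hx; exact ⟨⟨x, hS hnN hx⟩, hx, rfl⟩
        · rintro ⟨y, hy, rfl⟩; exact hy
      rw [h3, Finsupp.mem_span_image_iff_linearCombination] at h1
      obtain ⟨c', hc', heq⟩ := h1
      have := hli' heq
      rw [← this]
      exact (Finsupp.mem_supported' k c').1 hc' i hin
    · exact absurd (hS (not_le.1 hnN).le i.2) hin

noncomputable def coefMap (k : Type) [Field k] (P : Prop) : (PLift P → k) →ₗ[k] k :=
  if h : P then LinearMap.proj ⟨h⟩ else 0

theorem coefMap_pos {k : Type} [Field k] {P : Prop} (h : P) (f : PLift P → k) :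
    coefMap k P f = f ⟨h⟩ := by
  simp [coefMap, h]

theorem coefMap_neg {k : Type} [Field k] {P : Prop} (h : ¬ P) (f : PLift P → k) :
    coefMap k P f = 0 := by
  simp [coefMap, h]

noncomputable def thetaMap (k : Type) [Field k] {L : Type} (P : L → Prop) :
    (DFinsupp fun ℓ => (PLift (P ℓ) → k)) →ₗ[k] (L →₀ k) :=
  DFinsupp.lsum k (fun ℓ => (Finsupp.lsingle ℓ).comp (coefMap k (P ℓ)))

theorem thetaMap_single {k : Type} [Field k] {L : Type} (P : L → Prop) (ℓ : L)
    (f : PLift (P ℓ) → k) :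
    thetaMap k P (DFinsupp.single ℓ f) = Finsupp.single ℓ (coefMap k (P ℓ) f) := by
  simp [thetaMap]

theorem thetaMap_apply {k : Type} [Field k] {L : Type} (P : L → Prop)
    (f : DFinsupp fun ℓ => (PLift (P ℓ) → k)) (ℓ : L) :
    thetaMap k P f ℓ = coefMap k (P ℓ) (f ℓ) := by
  have : (Finsupp.lapply ℓ : (L →₀ k) →ₗ[k] k).comp (thetaMap k P)
      = (coefMap k (P ℓ)).comp (DFinsupp.lapply ℓ) := by
    refine DFinsupp.lhom_ext fun ℓ' x => ?_
    simp only [LinearMap.comp_apply, thetaMap_single, Finsupp.lapply_apply, DFinsupp.lapply_apply]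
    by_cases h : ℓ' = ℓ
    · subst h; simp
    · rw [Finsupp.single_eq_of_ne (Ne.symm h), DFinsupp.single_eq_of_ne (Ne.symm h), map_zero]
  exact LinearMap.congr_fun this f

theorem thetaMap_injective {k : Type} [Field k] {L : Type} (P : L → Prop) :
    Function.Injective (thetaMap k P) := by
  intro f g h
  refine DFinsupp.ext fun ℓ => funext fun p => ?_
  have := DFunLike.congr_fun h ℓ
  rwa [thetaMap_apply, thetaMap_apply, coefMap_pos p.down, coefMap_pos p.down] at this

theorem PersMod.map_map {k : Type} [Field k] {T : Type} [Preorder T] (V : PersMod k T)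
    {r s t : T} (h1 : r ≤ s) (h2 : s ≤ t) (x : V.space r) :
    V.map s t h2 (V.map r s h1 x) = V.map r t (h1.trans h2) x :=
  LinearMap.congr_fun (V.map_comp r s t h1 h2) x

/-- The subspace of vectors born strictly before `b`. -/
def earlier {k : Type} [Field k] {T : Type} [LinearOrder T] (V : PersMod k T) (b : T) :
    Submodule k (V.space b) :=
  ⨆ s : {s : T // s < b}, LinearMap.range (V.map s.1 b s.2.le)

/-- The vectors of `V_b` that die at index `n` at the latest. -/
def dieBy {k : Type} [Field k] {T : Type} [LinearOrder T] (V : PersMod k T) (r : T → ℕ)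
    (b : T) (n : ℕ) : Submodule k (V.space b) where
  carrier := {x | ∀ u (h : b ≤ u), n ≤ r u → V.map b u h x = 0}
  add_mem' := by
    intro x y hx hy u h hn
    rw [map_add, hx u h hn, hy u h hn, add_zero]
  zero_mem' := by
    intro u h hn
    exact map_zero _
  smul_mem' := by
    intro c x hx u h hn
    rw [map_smul, hx u h hn, smul_zero]

/-- Transition map of an interval module, on the plain function spaces. -/
noncomputable def plainMap {k : Type} [Field k] {T : Type} [LinearOrder T] (J : Set T) (hJ : IsIntervalSet J)
    (s t : T) (h : s ≤ t) : (PLift (s ∈ J) → k) →ₗ[k] (PLift (t ∈ J) → k) :=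
  (intervalModule k T J hJ).map s t h

theorem plainMap_apply {k : Type} [Field k] {T : Type} [LinearOrder T] (J : Set T)
    (hJ : IsIntervalSet J) (s t : T) (h : s ≤ t) (f : PLift (s ∈ J) → k) (ht : t ∈ J) :
    plainMap J hJ s t h f ⟨ht⟩ = coefMap k (s ∈ J) f := by
  by_cases hs : s ∈ J
  · rw [coefMap_pos hs]; exact dif_pos hs
  · rw [coefMap_neg hs]; exact dif_neg hs

theorem assemble {k : Type} [Field k] {T : Type} [LinearOrder T]
    (V : PersMod k T) {L : Type} (J : L → Set T) (hJ : ∀ ℓ, IsIntervalSet (J ℓ))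
    (w : ∀ t, L → V.space t) (hw_dead : ∀ t ℓ, t ∉ J ℓ → w t ℓ = 0)
    (hw_map : ∀ s t (h : s ≤ t) ℓ, s ∈ J ℓ → V.map s t h (w s ℓ) = w t ℓ)
    (hindep : ∀ t (a : L →₀ k), (∀ ℓ, t ∉ J ℓ → a ℓ = 0) →
      Finsupp.linearCombination k (w t) a = 0 → a = 0)
    (hspanning : ∀ t, Submodule.span k (Set.range (w t)) = ⊤) :
    PersIso V (dsum fun ℓ => intervalModule k T (J ℓ) (hJ ℓ)) := by
  let Φ : ∀ t, (DFinsupp fun ℓ => (PLift (t ∈ J ℓ) → k)) →ₗ[k] V.space t :=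
    fun t => (Finsupp.linearCombination k (w t)).comp (thetaMap k (fun ℓ => t ∈ J ℓ))
  have hinj : ∀ t, Function.Injective (Φ t) := by
    intro t
    rw [← LinearMap.ker_eq_bot, LinearMap.ker_eq_bot']
    intro f hf
    apply thetaMap_injective (k := k) (fun ℓ => t ∈ J ℓ)
    rw [map_zero]
    refine hindep t _ (fun ℓ hℓ => ?_) hf
    rw [thetaMap_apply, coefMap_neg hℓ]
  have hsurj : ∀ t, Function.Surjective (Φ t) := by
    intro t
    rw [← LinearMap.range_eq_top, eq_top_iff, ← hspanning t, Submodule.span_le]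
    rintro _ ⟨ℓ, rfl⟩
    by_cases h : t ∈ J ℓ
    · refine ⟨DFinsupp.single ℓ (fun _ => 1), ?_⟩
      rw [LinearMap.comp_apply, thetaMap_single, coefMap_pos h,
        Finsupp.linearCombination_single, one_smul]
    · rw [hw_dead _ _ h]
      exact zero_mem _
  have hnat : ∀ s t (h : s ≤ t), (Φ t).comp
      (DFinsupp.mapRange.linearMap (fun ℓ => plainMap (k := k) (J ℓ) (hJ ℓ) s t h)) =
        (V.map s t h).comp (Φ s) := by
    intro s t h
    refine DFinsupp.lhom_ext fun ℓ x => ?_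
    simp only [Φ, LinearMap.comp_apply]
    rw [DFinsupp.mapRange.linearMap_apply, DFinsupp.mapRange_single, thetaMap_single,
      thetaMap_single, Finsupp.linearCombination_single, Finsupp.linearCombination_single,
      map_smul]
    by_cases hs : s ∈ J ℓ
    · rw [hw_map s t h ℓ hs]
      by_cases ht : t ∈ J ℓ
      · rw [coefMap_pos ht, plainMap_apply]
      · rw [hw_dead t ℓ ht, smul_zero, smul_zero]
    · rw [coefMap_neg hs, zero_smul]
      by_cases ht : t ∈ J ℓ
      · rw [coefMap_pos ht, plainMap_apply, coefMap_neg hs, zero_smul]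
      · rw [hw_dead t ℓ ht, smul_zero]
  let E : ∀ t, (DFinsupp fun ℓ => (PLift (t ∈ J ℓ) → k)) ≃ₗ[k] V.space t :=
    fun t => LinearEquiv.ofBijective (Φ t) ⟨hinj t, hsurj t⟩
  have hE : ∀ s t (h : s ≤ t), (E t).symm.toLinearMap.comp (V.map s t h) =
      (DFinsupp.mapRange.linearMap (fun ℓ => plainMap (k := k) (J ℓ) (hJ ℓ) s t h)).comp
        (E s).symm.toLinearMap := by
    intro s t h
    refine LinearMap.ext fun x => ?_
    obtain ⟨y, rfl⟩ := (E s).surjective x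
    simp only [LinearMap.comp_apply, LinearEquiv.coe_coe]
    rw [LinearEquiv.symm_apply_eq, LinearEquiv.symm_apply_apply]
    exact (LinearMap.congr_fun (hnat s t h) y).symm
  exact ⟨fun t => (E t).symm, hE⟩

theorem linearOrder_case {k : Type} [Field k] {T : Type} [LinearOrder T] [Fintype T]
    (V : PersMod k T) :
    ∃ (L : Type) (J : L → Set T) (hJ : ∀ ℓ, IsIntervalSet (J ℓ)),
      PersIso V (dsum fun ℓ => intervalModule k T (J ℓ) (hJ ℓ)) := by
  obtain ⟨r, hr, N, hrN⟩ : ∃ r : T → ℕ, StrictMono r ∧ ∃ N, ∀ t, r t < N :=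
    ⟨fun t => ((monoEquivOfFin T rfl).symm t : Fin _).1,
      fun a b h => (monoEquivOfFin T rfl).symm.strictMono h, Fintype.card T, fun t => Fin.isLt _⟩
  have hex : ∀ b : T, _ := fun b => exists_adapted_lift (earlier V b) (dieBy V r b)
    (fun m n hmn x hx u h hn => hx u h (hmn.trans hn)) N
    (by rw [eq_top_iff]; intro x _ u h hn; exact absurd hn (not_le.2 (hrN u)))
  choose ι l d hmem hne hspan hind using hex
  -- every basis vector is alive at its birth
  have hdb : ∀ b i, r b < d b i := by
    intro b i
    by_contra hcon
    have := hmem b i b le_rfl (not_lt.1 hcon)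
    rw [V.map_id] at this
    exact hne b i this
  let J : (Σ b, ι b) → Set T := fun ℓ => {t | ℓ.1 ≤ t ∧ r t < d ℓ.1 ℓ.2}
  have hJ : ∀ ℓ, IsIntervalSet (J ℓ) := fun ℓ =>
    ⟨⟨ℓ.1, le_rfl, hdb _ _⟩, fun a b c ha hc hab hbc =>
      ⟨ha.1.trans hab, (hr.monotone hbc).trans_lt hc.2⟩⟩
  let w : ∀ t, (Σ b, ι b) → V.space t := fun t ℓ =>
    if h : ℓ.1 ≤ t then V.map ℓ.1 t h (l ℓ.1 ℓ.2) else 0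
  have hw_pos : ∀ t (ℓ : Σ b, ι b) (h : ℓ.1 ≤ t), w t ℓ = V.map ℓ.1 t h (l ℓ.1 ℓ.2) :=
    fun t ℓ h => dif_pos h
  have hw_neg : ∀ t (ℓ : Σ b, ι b), ¬ ℓ.1 ≤ t → w t ℓ = 0 := fun t ℓ h => dif_neg h
  have hw_dead : ∀ t ℓ, t ∉ J ℓ → w t ℓ = 0 := by
    intro t ℓ h
    by_cases hb : ℓ.1 ≤ t
    · rw [hw_pos t ℓ hb]
      exact hmem _ _ t hb (not_lt.1 fun h' => h ⟨hb, h'⟩)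
    · exact hw_neg t ℓ hb
  have hw_map : ∀ s t (h : s ≤ t) ℓ, s ∈ J ℓ → V.map s t h (w s ℓ) = w t ℓ := by
    intro s t h ℓ hs
    rw [hw_pos s ℓ hs.1, hw_pos t ℓ (hs.1.trans h), V.map_map]
  -- independence
  have hindep : ∀ t (a : (Σ b, ι b) →₀ k), (∀ ℓ, t ∉ J ℓ → a ℓ = 0) →
      Finsupp.linearCombination k (w t) a = 0 → a = 0 := by
    intro t a ha h0
    have hsum : ∑ b : T, (if h : b ≤ t then
        V.map b t h (Finsupp.linearCombination k (l b) (a.split b)) else 0) = 0 := by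
      refine Eq.trans ?_ h0
      rw [Finsupp.linearCombination_apply, Finsupp.sigma_sum]
      symm
      rw [Finset.sum_subset (Finset.subset_univ _)]
      · refine Finset.sum_congr rfl fun b _ => ?_
        by_cases hb : b ≤ t
        · rw [dif_pos hb, Finsupp.apply_linearCombination, Finsupp.linearCombination_apply]
          refine Finset.sum_congr rfl fun i _ => ?_
          simp only [Function.comp_apply]
          rw [hw_pos t ⟨b, i⟩ hb]
        · rw [dif_neg hb]
          apply Finset.sum_eq_zero
          intro i _
          simp only
          rw [hw_neg t ⟨b, i⟩ hb, smul_zero]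
      · intro b _ hb
        rw [Finsupp.mem_splitSupport_iff_nonzero, not_not] at hb
        rw [hb, Finsupp.sum_zero_index]
    have main : ∀ b, a.split b = 0 := by
      intro b0
      induction b0 using WellFoundedGT.induction with
      | ind b0 ih =>
        by_cases hb0 : b0 ≤ t
        · let m : ∀ b, V.space b := fun b => Finsupp.linearCombination k (l b) (a.split b)
          let z : V.space b0 := ∑ b : T, if h : b < b0 then V.map b b0 h.le (m b) else 0
          have hz : z ∈ earlier V b0 := by
            refine Submodule.sum_mem _ fun b _ => ?_
            by_cases h : b < b0
            · rw [dif_pos h]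
              exact (le_iSup (fun s : {s : T // s < b0} => LinearMap.range (V.map s.1 b0 s.2.le))
                ⟨b, h⟩) ⟨_, rfl⟩
            · rw [dif_neg h]; exact zero_mem _
          have hzm : V.map b0 t hb0 (z + m b0) = 0 := by
            rw [← hsum, map_add]
            change V.map b0 t hb0 (∑ b : T, if h : b < b0 then V.map b b0 h.le (m b) else 0) + _ = _
            rw [map_sum]
            rw [← Finset.sum_erase_add (a := b0) Finset.univ (fun b => V.map b0 t hb0
                (if h : b < b0 then V.map b b0 h.le (m b) else 0)) (Finset.mem_univ b0),
              ← Finset.sum_erase_add (a := b0) Finset.univ (fun b => if h : b ≤ t then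
                V.map b t h (Finsupp.linearCombination k (l b) (a.split b)) else 0)
                (Finset.mem_univ b0)]
            rw [dif_pos hb0, dif_neg (lt_irrefl b0), map_zero, add_zero]
            congr 1
            refine Finset.sum_congr rfl fun b hb => ?_
            rcases lt_or_gt_of_ne (Finset.ne_of_mem_erase hb) with h | h
            · rw [dif_pos h, dif_pos (h.le.trans hb0), V.map_map]
            · rw [dif_neg h.not_gt, map_zero, ih b h]
              simp
          have hmb : m b0 ∈ earlier V b0 ⊔ dieBy V r b0 (r t) := by
            have : m b0 = -z + (z + m b0) := by abel
            rw [this]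
            refine Submodule.add_mem_sup (neg_mem hz) ?_
            intro u hu hn
            have htu : t ≤ u := hr.le_iff_le.1 hn
            rw [← V.map_map hb0 htu, hzm, map_zero]
          ext i
          by_cases hi : r t < d b0 i
          · exact hind b0 (r t) (a.split b0) hmb i hi
          · rw [Finsupp.split_apply]
            exact ha ⟨b0, i⟩ fun h => hi h.2
        · ext i
          rw [Finsupp.split_apply]
          exact ha ⟨b0, i⟩ fun h => hb0 h.1
    ext ⟨b, i⟩
    rw [← Finsupp.split_apply, main b]
    rfl
  -- spanning
  have hspanning : ∀ t, Submodule.span k (Set.range (w t)) = ⊤ := by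
    intro t
    induction t using WellFoundedLT.induction with
    | ind t ih =>
      rw [eq_top_iff, ← hspan t, sup_le_iff]
      constructor
      · refine iSup_le fun s => ?_
        rw [LinearMap.range_eq_map, ← ih s.1 s.2, Submodule.map_span, Submodule.span_le]
        rintro _ ⟨_, ⟨ℓ, rfl⟩, rfl⟩
        by_cases h : s.1 ∈ J ℓ
        · rw [hw_map _ _ _ _ h]
          exact Submodule.subset_span ⟨ℓ, rfl⟩
        · rw [hw_dead _ _ h, map_zero]
          exact zero_mem _
      · rw [Submodule.span_le]
        rintro _ ⟨i, rfl⟩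
        refine Submodule.subset_span ⟨⟨t, i⟩, ?_⟩
        rw [hw_pos t ⟨t, i⟩ le_rfl, V.map_id]
        rfl
  exact ⟨_, J, hJ, assemble V J hJ w hw_dead hw_map hindep hspanning⟩

theorem stmt1 {k : Type} [Field k] (T : Set ℝ) (hT : T.Finite) (V : PersMod k ↥T) :
    ∃ (L : Type) (J : L → Set ↥T) (hJ : ∀ ℓ, IsIntervalSet (J ℓ)),
      PersIso V (dsum fun ℓ => intervalModule k ↥T (J ℓ) (hJ ℓ)) := by
  have : Fintype ↥T := hT.fintype
  exact linearOrder_case V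
end

section
/- Let T ⊆ ℝ be locally finite (i.e., T has no accumulation points in ℝ) and let V be a persistence module over T with dim_k V_t < ∞ for every t ∈ T. Then V is isomorphic to a direct sum of interval modules. -/
attribute [local instance] Classical.propDecidable

open scoped ENNReal

section Decomposition

theorem chain_min {k M : Type} [Field k] [AddCommGroup M] [Module k M] [Module.Finite k M]
    {ι : Type} [Nonempty ι] (f : ι → Submodule k M)
    (htot : ∀ i j, f i ≤ f j ∨ f j ≤ f i) : ∃ i, ∀ j, f i ≤ f j := by
  have hwf : WellFounded ((· < ·) : Submodule k M → Submodule k M → Prop) := wellFounded_lt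
  obtain ⟨m, ⟨i, rfl⟩, hm⟩ := hwf.has_min (Set.range f) (Set.range_nonempty f)
  refine ⟨i, fun j => ?_⟩
  rcases htot i j with h | h
  · exact h
  · by_contra hn
    exact hm (f j) ⟨j, rfl⟩ (lt_of_le_not_ge h hn)

theorem chain_max {k M : Type} [Field k] [AddCommGroup M] [Module k M] [Module.Finite k M]
    {ι : Type} [Nonempty ι] (f : ι → Submodule k M)
    (htot : ∀ i j, f i ≤ f j ∨ f j ≤ f i) : ∃ i, ∀ j, f j ≤ f i := by
  have hwf : WellFounded ((· > ·) : Submodule k M → Submodule k M → Prop) := wellFounded_gt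
  obtain ⟨m, ⟨i, rfl⟩, hm⟩ := hwf.has_min (Set.range f) (Set.range_nonempty f)
  refine ⟨i, fun j => ?_⟩
  rcases htot i j with h | h
  · by_contra hn
    exact hm (f j) ⟨j, rfl⟩ (lt_of_le_not_ge h hn)
  · exact h

variable {k : Type} [Field k]

theorem PersMod.mm {T : Type} [Preorder T] (V : PersMod k T) {r s t : T} (h1 : r ≤ s) (h2 : s ≤ t)
    (x : V.space r) : V.map s t h2 (V.map r s h1 x) = V.map r t (h1.trans h2) x :=
  LinearMap.congr_fun (V.map_comp r s t h1 h2) x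

theorem PersMod.mid {T : Type} [Preorder T] (V : PersMod k T) {t : T} (h : t ≤ t)
    (x : V.space t) : V.map t t h x = x :=
  LinearMap.congr_fun (V.map_id t) x

theorem PersMod.range_le {T : Type} [Preorder T] (V : PersMod k T) {r s t : T}
    (h1 : r ≤ s) (h2 : s ≤ t) :
    LinearMap.range (V.map r t (h1.trans h2)) ≤ LinearMap.range (V.map s t h2) := by
  rintro _ ⟨y, rfl⟩
  exact ⟨V.map r s h1 y, V.mm h1 h2 y⟩

theorem PersMod.ker_le {T : Type} [Preorder T] (V : PersMod k T) {r s t : T}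
    (h1 : r ≤ s) (h2 : s ≤ t) :
    LinearMap.ker (V.map r s h1) ≤ LinearMap.ker (V.map r t (h1.trans h2)) := by
  intro y hy
  rw [LinearMap.mem_ker] at hy ⊢
  rw [← V.mm h1 h2 y, hy, map_zero]

/-- Elements in all images lift to compatible families. -/
theorem lift_family {T : Type} [LinearOrder T] [Countable T] (V : PersMod k T)
    (hfd : ∀ t, Module.Finite k (V.space t)) (t₀ : T) (ht₀ : ∀ t, t ≤ t₀) (x : V.space t₀)
    (hx : ∀ s, x ∈ LinearMap.range (V.map s t₀ (ht₀ s))) :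
    ∃ y : ∀ t, V.space t, y t₀ = x ∧ ∀ s t (h : s ≤ t), V.map s t h (y s) = y t := by
  have : Nonempty T := ⟨t₀⟩
  let A : ∀ t, Submodule k (V.space t) := fun t =>
    ⨅ r : {r // r ≤ t}, LinearMap.range (V.map r.1 t r.2)
  have hA : ∀ t, ∃ r, ∃ h : r ≤ t, LinearMap.range (V.map r t h) ≤ A t := by
    intro t
    have := hfd t
    have : Nonempty {r // r ≤ t} := ⟨⟨t, le_rfl⟩⟩
    obtain ⟨i, hi⟩ := chain_min (fun r : {r // r ≤ t} => LinearMap.range (V.map r.1 t r.2))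
      (fun i j => (le_total i.1 j.1).imp (fun h => V.range_le h j.2) (fun h => V.range_le h i.2))
    exact ⟨i.1, i.2, le_iInf hi⟩
  have hlift : ∀ s t (h : s ≤ t) (y : A t), ∃ z : A s, V.map s t h z.1 = y.1 := by
    intro s t h y
    obtain ⟨r, hr, hle⟩ := hA s
    have := (Submodule.mem_iInf _).1 y.2 ⟨r, hr.trans h⟩
    obtain ⟨w, hw⟩ := this
    exact ⟨⟨V.map r s hr w, hle ⟨w, rfl⟩⟩, by rw [← hw]; exact V.mm hr h w⟩
  obtain ⟨r, hr, hlim⟩ := Filter.exists_seq_antitone_tendsto_atTop_atBot T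
  have hxA : x ∈ A t₀ := (Submodule.mem_iInf _).2 fun s => hx s.1
  choose L hL using hlift
  let y : ∀ n, A (r n) := fun n => Nat.rec (L (r 0) t₀ (ht₀ _) ⟨x, hxA⟩)
    (fun n yn => L (r (n+1)) (r n) (hr n.le_succ) yn) n
  have hy0 : V.map (r 0) t₀ (ht₀ _) (y 0).1 = x := hL _ _ _ _
  have hys : ∀ n, V.map (r (n+1)) (r n) (hr n.le_succ) (y (n+1)).1 = (y n).1 :=
    fun n => hL _ _ _ _
  have hymn : ∀ m n (h : m ≤ n), V.map (r n) (r m) (hr h) (y n).1 = (y m).1 := by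
    intro m n h
    induction n, h using Nat.le_induction with
    | base => exact V.mid _ _
    | succ n hmn ih => rw [← V.mm (hr n.le_succ) (hr hmn), hys, ih]
  have hex : ∀ t, ∃ n, r n ≤ t := fun t => (hlim.eventually_le_atBot t).exists
  choose N hN using hex
  have key : ∀ t n (h : r n ≤ t), V.map (r (N t)) t (hN t) (y (N t)).1 = V.map (r n) t h (y n).1 := by
    intro t n h
    rcases le_total n (N t) with h' | h'
    · rw [← hymn _ _ h', V.mm]
    · rw [← hymn _ _ h', V.mm]
  refine ⟨fun t => V.map (r (N t)) t (hN t) (y (N t)).1, ?_, ?_⟩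
  · show V.map (r (N t₀)) t₀ (hN t₀) (y (N t₀)).1 = x
    rw [key t₀ 0 (ht₀ _), hy0]
  · intro s t h
    show V.map s t h (V.map (r (N s)) s (hN s) (y (N s)).1) = _
    rw [V.mm]
    exact (key t (N s) _).symm

/-- restriction to a subtype -/
def PersMod.restr {T : Type} [Preorder T] (V : PersMod k T) (P : T → Prop) :
    PersMod k {t // P t} where
  space t := V.space t.1
  addCommGroup := fun _ => inferInstance
  module := fun _ => inferInstance
  map s t h := V.map s.1 t.1 h
  map_id t := V.map_id t.1
  map_comp r s t h1 h2 := V.map_comp r.1 s.1 t.1 h1 h2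

/-- pointwise dual -/
def PersMod.dual {T : Type} [Preorder T] (V : PersMod k T) : PersMod k Tᵒᵈ where
  space t := Module.Dual k (V.space (OrderDual.ofDual t))
  addCommGroup := fun _ => inferInstance
  module := fun _ => inferInstance
  map s t h := (V.map (OrderDual.ofDual t) (OrderDual.ofDual s) h).dualMap
  map_id t := by rw [V.map_id]; rfl
  map_comp r s t h1 h2 := by
    refine (LinearMap.dualMap_comp_dualMap _ _).trans ?_
    exact congrArg LinearMap.dualMap (V.map_comp (OrderDual.ofDual t) (OrderDual.ofDual s)
      (OrderDual.ofDual r) h2 h1)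

theorem extend_family {T : Type} [LinearOrder T] [Countable T] (V : PersMod k T)
    (hfd : ∀ t, Module.Finite k (V.space t)) (t₀ : T) (ht₀ : ∀ t, t₀ ≤ t)
    (φ : Module.Dual k (V.space t₀))
    (hφ : ∀ s, LinearMap.ker (V.map t₀ s (ht₀ s)) = ⊥) :
    ∃ y : ∀ t, Module.Dual k (V.space t), y t₀ = φ ∧
      ∀ s t (h : s ≤ t), (y t).comp (V.map s t h) = y s := by
  have : Countable Tᵒᵈ := ‹Countable T›
  obtain ⟨y, h1, h2⟩ := lift_family V.dual
    (fun t => by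
      have := hfd (OrderDual.ofDual t)
      exact (inferInstance : Module.Finite k (Module.Dual k (V.space (OrderDual.ofDual t)))))
    (OrderDual.toDual t₀) (fun t => ht₀ (OrderDual.ofDual t)) φ (fun s => by
      show φ ∈ LinearMap.range (V.map t₀ (OrderDual.ofDual s) (ht₀ _)).dualMap
      rw [LinearMap.range_dualMap_eq_dualAnnihilator_ker, hφ]
      simp)
  exact ⟨fun t => y (OrderDual.toDual t), h1, fun s t h => h2 (OrderDual.toDual t) (OrderDual.toDual s) h⟩

theorem exists_summand {T : Type} [LinearOrder T] [Countable T] (V : PersMod k T)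
    (hfd : ∀ t, Module.Finite k (V.space t)) (t₀ : T) (hV : ∃ v : V.space t₀, v ≠ 0) :
    ∃ (X : ∀ t, V.space t) (Φ : ∀ t, Module.Dual k (V.space t)),
      X t₀ ≠ 0 ∧
      (∀ s t (h : s ≤ t), X s ≠ 0 → V.map s t h (X s) = X t) ∧
      (∀ s t (h : s ≤ t), X t ≠ 0 → (Φ t).comp (V.map s t h) = Φ s) ∧
      (∀ t, X t = 0 → Φ t = 0) ∧ (∀ t, X t ≠ 0 → Φ t (X t) = 1) := by
  have := hfd t₀
  -- the minimal nonzero kernel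
  have hK : ∃ K : Submodule k (V.space t₀), K ≠ ⊥ ∧ ∀ u (h : t₀ ≤ u),
      LinearMap.ker (V.map t₀ u h) ≠ ⊥ → K ≤ LinearMap.ker (V.map t₀ u h) := by
    let f : Option {u // ∃ h : t₀ ≤ u, LinearMap.ker (V.map t₀ u h) ≠ ⊥} →
      Submodule k (V.space t₀) := fun o => o.elim ⊤ fun u => LinearMap.ker (V.map t₀ u.1 u.2.1)
    obtain ⟨i, hi⟩ := chain_min f (by
      rintro (_ | i) (_ | j)
      · left; exact le_top
      · right; exact le_top
      · left; exact le_top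
      · exact (le_total i.1 j.1).imp (fun h => V.ker_le _ h) (fun h => V.ker_le _ h))
    refine ⟨f i, ?_, fun u h hu => hi (some ⟨u, h, hu⟩)⟩
    rcases i with _ | i
    · obtain ⟨v, hv⟩ := hV
      exact (Submodule.ne_bot_iff _).2 ⟨v, Submodule.mem_top, hv⟩
    · exact i.2.2
  obtain ⟨K, hK0, hK⟩ := hK
  let P : T → Prop := fun s => ∃ h : s ≤ t₀, LinearMap.range (V.map s t₀ h) ⊓ K ≠ ⊥
  let Q : T → Prop := fun u => ∃ h : t₀ ≤ u, LinearMap.ker (V.map t₀ u h) = ⊥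
  have hid : V.map t₀ t₀ le_rfl = LinearMap.id := V.map_id t₀
  have hPt : P t₀ := ⟨le_rfl, by rw [hid, LinearMap.range_id, top_inf_eq]; exact hK0⟩
  have hQt : Q t₀ := ⟨le_rfl, by rw [hid, LinearMap.ker_id]⟩
  have hPup : ∀ s t, s ≤ t → t ≤ t₀ → P s → P t := by
    rintro s t hst ht ⟨h, hs⟩
    refine ⟨ht, fun h0 => hs ?_⟩
    rw [eq_bot_iff, ← h0]
    exact inf_le_inf_right _ (V.range_le hst ht)
  have hQdn : ∀ s t, s ≤ t → t₀ ≤ s → Q t → Q s := by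
    rintro s t hst ht ⟨h, hs⟩
    refine ⟨ht, ?_⟩
    rw [eq_bot_iff, ← hs]
    exact V.ker_le ht hst
  -- the vector
  have hx : ∃ x : V.space t₀, x ≠ 0 ∧ x ∈ K ∧ ∀ s (h : P s), x ∈ LinearMap.range (V.map s t₀ h.1) := by
    have : Nonempty {s // P s} := ⟨⟨t₀, hPt⟩⟩
    obtain ⟨i, hi⟩ := chain_min (fun s : {s // P s} => LinearMap.range (V.map s.1 t₀ s.2.1) ⊓ K)
      (fun i j => (le_total i.1 j.1).imp (fun h => inf_le_inf_right _ (V.range_le h j.2.1))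
        (fun h => inf_le_inf_right _ (V.range_le h i.2.1)))
    obtain ⟨x, hx, hx0⟩ := (Submodule.ne_bot_iff _).1 i.2.2
    exact ⟨x, hx0, hx.2, fun s h => (hi ⟨s, h⟩ hx).1⟩
  obtain ⟨x, hx0, hxK, hxP⟩ := hx
  -- the functional
  have hφ : ∃ φ : Module.Dual k (V.space t₀), φ x = 1 ∧
      ∀ s (h : s ≤ t₀), ¬ P s → φ.comp (V.map s t₀ h) = 0 := by
    have : ∃ A : Submodule k (V.space t₀), A ⊓ K = ⊥ ∧
        ∀ s (h : s ≤ t₀), ¬ P s → LinearMap.range (V.map s t₀ h) ≤ A := by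
      let f : Option {s // s ≤ t₀ ∧ ¬ P s} → Submodule k (V.space t₀) :=
        fun o => o.elim ⊥ fun s => LinearMap.range (V.map s.1 t₀ s.2.1)
      obtain ⟨i, hi⟩ := chain_max f (by
        rintro (_ | i) (_ | j)
        · left; exact bot_le
        · left; exact bot_le
        · right; exact bot_le
        · exact (le_total i.1 j.1).imp (fun h => V.range_le h _) (fun h => V.range_le h _))
      refine ⟨f i, ?_, fun s h hs => hi (some ⟨s, h, hs⟩)⟩
      rcases i with _ | i
      · exact bot_inf_eq _
      · by_contra hne
        exact i.2.2 ⟨i.2.1, hne⟩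
    obtain ⟨A, hAK, hA⟩ := this
    have hxA : x ∉ A := fun h => hx0 (by
      have : x ∈ A ⊓ K := ⟨h, hxK⟩
      rwa [hAK, Submodule.mem_bot] at this)
    obtain ⟨f, hf, hfA⟩ := Submodule.exists_le_ker_of_notMem hxA
    refine ⟨(f x)⁻¹ • f, by simp [hf], fun s h hs => LinearMap.ext fun v => ?_⟩
    have : f (V.map s t₀ h v) = 0 := hfA (hA s h hs ⟨v, rfl⟩)
    simp [this]
  obtain ⟨φ, hφx, hφP⟩ := hφ
  obtain ⟨xl, hxl0, hxl⟩ := lift_family (V.restr P) (fun t => hfd t.1) ⟨t₀, hPt⟩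
    (fun t => t.2.1) x (fun s => hxP s.1 s.2)
  obtain ⟨φr, hφr0, hφr⟩ := extend_family (V.restr Q) (fun t => hfd t.1) ⟨t₀, hQt⟩
    (fun t => t.2.1) φ (fun s => s.2.2)
  let X : ∀ t, V.space t := fun t =>
    if h : P t then xl ⟨t, h⟩ else if h : t₀ ≤ t then V.map t₀ t h x else 0
  let Φ : ∀ t, Module.Dual k (V.space t) := fun t =>
    if h : Q t then φr ⟨t, h⟩ else if h : t ≤ t₀ then φ.comp (V.map t t₀ h) else 0
  have hXP : ∀ t (h : P t), X t = xl ⟨t, h⟩ := fun t h => dif_pos h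
  have hΦQ : ∀ t (h : Q t), Φ t = φr ⟨t, h⟩ := fun t h => dif_pos h
  have hXr : ∀ t (h : t₀ ≤ t), X t = V.map t₀ t h x := by
    intro t h
    by_cases hP : P t
    · obtain rfl : t = t₀ := le_antisymm hP.1 h
      rw [hXP t hP, V.mid]; exact hxl0
    · exact (dif_neg hP).trans (dif_pos h)
  have hΦl : ∀ t (h : t ≤ t₀), Φ t = φ.comp (V.map t t₀ h) := by
    intro t h
    by_cases hQ : Q t
    · obtain rfl : t = t₀ := le_antisymm h hQ.1
      rw [hΦQ t hQ, V.map_id]; exact hφr0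
    · exact (dif_neg hQ).trans (dif_pos h)
  have hXn : ∀ t, t ≤ t₀ → ¬ P t → X t = 0 := by
    intro t h hP
    have h' : ¬ t₀ ≤ t := fun h' => hP (by rwa [le_antisymm h h'])
    exact (dif_neg hP).trans (dif_neg h')
  have hΦn : ∀ t, t₀ ≤ t → ¬ Q t → Φ t = 0 := by
    intro t h hQ
    have h' : ¬ t ≤ t₀ := fun h' => hQ (by rwa [le_antisymm h' h])
    exact (dif_neg hQ).trans (dif_neg h')
  have hXn' : ∀ t, t₀ ≤ t → ¬ Q t → X t = 0 := by
    intro t h hQ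
    rw [hXr t h]
    exact hK t h (fun h0 => hQ ⟨h, h0⟩) hxK
  have hΦn' : ∀ t, t ≤ t₀ → ¬ P t → Φ t = 0 := by
    intro t h hP
    rw [hΦl t h, hφP t h hP]
  have hXl : ∀ t (h : P t), V.map t t₀ h.1 (X t) = x := by
    intro t h
    rw [hXP t h, ← hxl0]
    exact hxl ⟨t, h⟩ ⟨t₀, hPt⟩ h.1
  have hΦr : ∀ t (h : Q t), (Φ t).comp (V.map t₀ t h.1) = φ := by
    intro t h
    rw [hΦQ t h, ← hφr0]
    exact hφr ⟨t₀, hQt⟩ ⟨t, h⟩ h.1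
  have hone : ∀ t, X t ≠ 0 → Φ t (X t) = 1 := by
    intro t h
    rcases le_total t t₀ with ht | ht
    · have hP : P t := by
        by_contra hP
        exact h (hXn t ht hP)
      rw [hΦl t ht, LinearMap.comp_apply, hXl t hP, hφx]
    · have hQ : Q t := by
        by_contra hQ
        exact h (hXn' t ht hQ)
      rw [hXr t ht, ← LinearMap.comp_apply, hΦr t hQ, hφx]
  refine ⟨X, Φ, ?_, ?_, ?_, ?_, hone⟩
  · rw [hXr t₀ le_rfl, V.mid]; exact hx0
  · intro s t h hs
    rcases le_total s t₀ with hs0 | hs0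
    · have hP : P s := by
        by_contra hP
        exact hs (hXn s hs0 hP)
      rcases le_total t t₀ with ht | ht
      · have hPt := hPup s t h ht hP
        rw [hXP s hP, hXP t hPt]
        exact hxl ⟨s, hP⟩ ⟨t, hPt⟩ h
      · rw [hXr t ht, ← V.mm hs0 ht, hXl s hP]
    · rw [hXr s hs0, hXr t (hs0.trans h), V.mm]
  · intro s t h ht
    rcases le_total t₀ t with ht0 | ht0
    · have hQ : Q t := by
        by_contra hQ
        exact ht (hXn' t ht0 hQ)
      rcases le_total t₀ s with hs | hs
      · have hQs := hQdn s t h hs hQ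
        rw [hΦQ s hQs, hΦQ t hQ]
        exact hφr ⟨s, hQs⟩ ⟨t, hQ⟩ h
      · rw [hΦl s hs, ← V.map_comp s t₀ t hs ht0, ← LinearMap.comp_assoc, hΦr t hQ]
    · rw [hΦl s (h.trans ht0), hΦl t ht0, LinearMap.comp_assoc, V.map_comp]
  · intro t h
    rcases le_total t t₀ with ht | ht
    · refine hΦn' t ht fun hP => hx0 ?_
      rw [← hXl t hP, h, map_zero]
    · refine hΦn t ht fun hQ => ?_
      have := LinearMap.congr_fun (hΦr t hQ) x
      rw [LinearMap.comp_apply, ← hXr t ht, h, map_zero, hφx] at this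
      exact zero_ne_one this

/-- A compatible family generating an interval submodule. -/
def GoodFam {T : Type} [Preorder T] (V : PersMod k T) (x : ∀ t, V.space t) : Prop :=
  (∃ t, x t ≠ 0) ∧ ∀ s t (h : s ≤ t), x s ≠ 0 → V.map s t h (x s) = x t

theorem GoodFam.interval {T : Type} [Preorder T] {V : PersMod k T} {x : ∀ t, V.space t}
    (hx : GoodFam V x) : IsIntervalSet {t | x t ≠ 0} := by
  refine ⟨hx.1, fun r s t hr ht h1 h2 hs => ht ?_⟩
  rw [← hx.2 r t (h1.trans h2) hr, ← V.mm h1 h2, hx.2 r s h1 hr, hs, map_zero]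

/-- partial decompositions -/
structure PDec {T : Type} [Preorder T] (V : PersMod k T) where
  S : Set (∀ t, V.space t)
  W : ∀ t, Submodule k (V.space t)
  good : ∀ x ∈ S, GoodFam V x
  stable : ∀ s t (h : s ≤ t), ∀ w ∈ W s, V.map s t h w ∈ W t
  indep : ∀ t, LinearIndepOn k (fun x : ∀ t, V.space t => x t) {x | x ∈ S ∧ x t ≠ 0}
  compl : ∀ t, IsCompl (Submodule.span k ((fun x : ∀ t, V.space t => x t) '' S)) (W t)

instance {T : Type} [Preorder T] (V : PersMod k T) : Preorder (PDec V) where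
  le p q := p.S ⊆ q.S ∧ ∀ t, q.W t ≤ p.W t
  le_refl p := ⟨subset_rfl, fun _ => le_rfl⟩
  le_trans p q r h1 h2 := ⟨h1.1.trans h2.1, fun t => (h2.2 t).trans (h1.2 t)⟩

theorem PDec.chain_bdd {T : Type} [Preorder T] (V : PersMod k T)
    (hfd : ∀ t, Module.Finite k (V.space t)) (c : Set (PDec V))
    (hc : IsChain (· ≤ ·) c) (hne : c.Nonempty) : BddAbove c := by
  have : Nonempty c := hne.to_subtype
  have hmin : ∀ t, ∃ p : c, ∀ q : c, p.1.W t ≤ q.1.W t := by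
    intro t
    have := hfd t
    exact chain_min (fun p : c => p.1.W t)
      (fun p q => (hc.total p.2 q.2).symm.imp (fun h => h.2 t) (fun h => h.2 t))
  let U : PDec V :=
    { S := ⋃ p : c, p.1.S
      W := fun t => ⨅ p : c, p.1.W t
      good := by
        intro x hx
        obtain ⟨p, hp⟩ := Set.mem_iUnion.1 hx
        exact p.1.good x hp
      stable := by
        intro s t h w hw
        rw [Submodule.mem_iInf] at hw ⊢
        exact fun p => p.1.stable s t h w (hw p)
      indep := by
        intro t
        have e : {x | x ∈ (⋃ p : c, p.1.S) ∧ x t ≠ 0} = ⋃ p : c, {x | x ∈ p.1.S ∧ x t ≠ 0} := by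
          ext x
          simp only [Set.mem_setOf_eq, Set.mem_iUnion, exists_and_right]
        rw [e]
        refine linearIndepOn_iUnion_of_directed ?_ (fun p => p.1.indep t)
        intro p q
        rcases hc.total p.2 q.2 with h | h
        · exact ⟨q, fun x hx => ⟨h.1 hx.1, hx.2⟩, subset_rfl⟩
        · exact ⟨p, subset_rfl, fun x hx => ⟨h.1 hx.1, hx.2⟩⟩
      compl := by
        intro t
        obtain ⟨p, hp⟩ := hmin t
        have h1 : (⨅ q : c, q.1.W t) = p.1.W t := le_antisymm (iInf_le _ p) (le_iInf hp)
        have h2 : Submodule.span k ((fun x : ∀ t, V.space t => x t) '' (⋃ q : c, q.1.S)) =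
            Submodule.span k ((fun x : ∀ t, V.space t => x t) '' p.1.S) := by
          apply le_antisymm
          · rw [Submodule.span_le]
            rintro _ ⟨x, hx, rfl⟩
            obtain ⟨q, hq⟩ := Set.mem_iUnion.1 hx
            rcases hc.total p.2 q.2 with h | h
            · have hW : p.1.W t = q.1.W t := le_antisymm (hp q) (h.2 t)
              have hle : Submodule.span k ((fun x : ∀ t, V.space t => x t) '' p.1.S) ≤
                Submodule.span k ((fun x : ∀ t, V.space t => x t) '' q.1.S) :=
                Submodule.span_mono (Set.image_mono h.1)
              have heq := eq_of_le_of_inf_le_of_sup_le (z := p.1.W t) hle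
                (by rw [(p.1.compl t).inf_eq_bot, hW, (q.1.compl t).inf_eq_bot])
                (by rw [(p.1.compl t).sup_eq_top]; exact le_top)
              rw [heq]
              exact Submodule.subset_span ⟨x, hq, rfl⟩
            · exact Submodule.subset_span ⟨x, h.1 hq, rfl⟩
          · exact Submodule.span_mono (Set.image_mono (Set.subset_iUnion (fun q : c => q.1.S) p))
        rw [h1, h2]
        exact p.1.compl t }
  exact ⟨U, fun p hp => ⟨Set.subset_iUnion (fun q : c => q.1.S) ⟨p, hp⟩,
    fun t => iInf_le (fun q : c => q.1.W t) ⟨p, hp⟩⟩⟩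

/-- The complement as a persistence module. -/
def PDec.rest {T : Type} [Preorder T] {V : PersMod k T} (p : PDec V) : PersMod k T where
  space t := p.W t
  addCommGroup := fun _ => inferInstance
  module := fun _ => inferInstance
  map s t h := (V.map s t h).restrict (p.stable s t h)
  map_id t := LinearMap.ext fun x => Subtype.ext (V.mid le_rfl x.1)
  map_comp r s t h1 h2 := LinearMap.ext fun x => Subtype.ext (V.mm h1 h2 x.1)

theorem PDec.extend {T : Type} [LinearOrder T] [Countable T] {V : PersMod k T}
    (hfd : ∀ t, Module.Finite k (V.space t)) (p : PDec V) (t₀ : T) (h0 : p.W t₀ ≠ ⊥) :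
    ∃ q : PDec V, p ≤ q ∧ ¬ q ≤ p := by
  obtain ⟨v, hv, hv0⟩ := (Submodule.ne_bot_iff _).1 h0
  obtain ⟨X, Φ, hX0, hX, hΦ, hΦ0, hone⟩ := exists_summand p.rest
    (fun t => by
      have := hfd t
      exact (inferInstance : Module.Finite k (p.W t)))
    t₀ ⟨(⟨v, hv⟩ : p.W t₀), fun h => hv0 (congrArg Subtype.val h)⟩
  let Y : ∀ t, p.W t := X
  let Ψ : ∀ t, Module.Dual k (p.W t) := Φ
  have hY : ∀ s t (h : s ≤ t), Y s ≠ 0 → V.map s t h (Y s).1 = (Y t).1 :=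
    fun s t h hs => congrArg Subtype.val (hX s t h hs)
  have hΨ : ∀ s t (h : s ≤ t), Y t ≠ 0 → ∀ w : p.W s,
      Ψ t ⟨V.map s t h w.1, p.stable s t h w.1 w.2⟩ = Ψ s w :=
    fun s t h ht w => LinearMap.congr_fun (hΦ s t h ht) w
  have hΨ0 : ∀ t, Y t = 0 → Ψ t = 0 := hΦ0
  have hYone : ∀ t, Y t ≠ 0 → Ψ t (Y t) = 1 := hone
  have hY0 : Y t₀ ≠ 0 := hX0
  clear_value Y Ψ
  let y : ∀ t, V.space t := fun t => (Y t).1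
  have hy0 : ∀ t, y t ≠ 0 ↔ Y t ≠ 0 := fun t => by simp [y]
  have hyspan : ∀ t, y t ≠ 0 →
      y t ∉ Submodule.span k ((fun x : ∀ t, V.space t => x t) '' p.S) := by
    intro t ht h
    exact ht (Submodule.disjoint_def.1 (p.compl t).disjoint _ h (Y t).2)
  have hyS : y ∉ p.S := fun h =>
    hyspan t₀ ((hy0 t₀).2 hY0) (Submodule.subset_span ⟨y, h, rfl⟩)
  have hmem : ∀ t (w : V.space t), w ∈ (LinearMap.ker (Ψ t)).map (p.W t).subtype ↔
      ∃ h : w ∈ p.W t, Ψ t ⟨w, h⟩ = 0 := by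
    intro t w
    constructor
    · rintro ⟨w, hw, rfl⟩
      exact ⟨w.2, hw⟩
    · rintro ⟨h, hw⟩
      exact ⟨⟨w, h⟩, hw, rfl⟩
  let q : PDec V :=
    { S := insert y p.S
      W := fun t => (LinearMap.ker (Ψ t)).map (p.W t).subtype
      good := by
        rintro x (rfl | hx)
        · exact ⟨⟨t₀, (hy0 t₀).2 hY0⟩, fun s t h hs => hY s t h ((hy0 s).1 hs)⟩
        · exact p.good x hx
      stable := by
        intro s t h w hw
        obtain ⟨hw, hw0⟩ := (hmem s w).1 hw
        refine (hmem t _).2 ⟨p.stable s t h w hw, ?_⟩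
        by_cases ht : Y t = 0
        · rw [hΨ0 t ht]; rfl
        · rw [hΨ s t h ht ⟨w, hw⟩, hw0]
      indep := by
        intro t
        by_cases ht : y t = 0
        · refine (p.indep t).mono ?_
          rintro x ⟨rfl | hx, hx0⟩
          · exact absurd ht hx0
          · exact ⟨hx, hx0⟩
        · refine ((p.indep t).insert (x := y) ?_).mono ?_
          · exact fun h => hyspan t ht (Submodule.span_mono (Set.image_mono fun x hx => hx.1) h)
          · rintro x ⟨rfl | hx, hx0⟩
            · exact Or.inl rfl
            · exact Or.inr ⟨hx, hx0⟩
      compl := by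
        intro t
        rw [Set.image_insert_eq, Submodule.span_insert]
        constructor
        · rw [Submodule.disjoint_def]
          intro w hw hw'
          obtain ⟨hwW, hw0⟩ := (hmem t w).1 hw'
          obtain ⟨a, ha, b, hb, rfl⟩ := Submodule.mem_sup.1 hw
          obtain ⟨c, rfl⟩ := Submodule.mem_span_singleton.1 ha
          have hbW : b ∈ p.W t := by
            have := (p.W t).sub_mem hwW ((p.W t).smul_mem c (Y t).2)
            simpa [y] using this
          have hb0 : b = 0 := Submodule.disjoint_def.1 (p.compl t).disjoint _ hb hbW
          subst hb0
          by_cases ht : Y t = 0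
          · have : y t = 0 := by simp [y, ht]
            simp [this]
          · have h1 : (⟨c • y t + 0, hwW⟩ : p.W t) = c • Y t := by
              apply Subtype.ext; simp [y]
            rw [h1, map_smul, hYone t ht, smul_eq_mul, mul_one] at hw0
            simp [hw0]
        · rw [codisjoint_iff, eq_top_iff, ← (p.compl t).sup_eq_top]
          refine sup_le (le_sup_right.trans le_sup_left) ?_
          intro w hw
          by_cases ht : Y t = 0
          · refine Submodule.mem_sup_right ((hmem t w).2 ⟨hw, ?_⟩)
            rw [hΨ0 t ht]; rfl
          · have e : w = Ψ t ⟨w, hw⟩ • y t + (w - Ψ t ⟨w, hw⟩ • y t) := by abel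
            rw [e]
            refine Submodule.add_mem_sup (Submodule.mem_sup_left
              (Submodule.smul_mem _ _ (Submodule.mem_span_singleton_self _)))
              ((hmem t _).2 ⟨(p.W t).sub_mem hw ((p.W t).smul_mem _ (Y t).2), ?_⟩)
            have h1 : (⟨w - Ψ t ⟨w, hw⟩ • y t,
                (p.W t).sub_mem hw ((p.W t).smul_mem _ (Y t).2)⟩ : p.W t)
                = ⟨w, hw⟩ - Ψ t ⟨w, hw⟩ • Y t := rfl
            rw [h1, map_sub, map_smul, hYone t ht, smul_eq_mul, mul_one, sub_self] }
  refine ⟨q, ⟨Set.subset_insert _ _, fun t w hw => ((hmem t w).1 hw).1⟩, fun h => hyS ?_⟩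
  exact h.1 (Set.mem_insert _ _)

theorem exists_basis_family {T : Type} [LinearOrder T] [Countable T] (V : PersMod k T)
    (hfd : ∀ t, Module.Finite k (V.space t)) :
    ∃ S : Set (∀ t, V.space t), (∀ x ∈ S, GoodFam V x) ∧
      (∀ t, LinearIndepOn k (fun x : ∀ t, V.space t => x t) {x | x ∈ S ∧ x t ≠ 0}) ∧
      ∀ t, Submodule.span k ((fun x : ∀ t, V.space t => x t) '' S) = ⊤ := by
  have : Nonempty (PDec V) := ⟨
    { S := ∅
      W := fun _ => ⊤
      good := by simp
      stable := by simp
      indep := by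
        intro t
        have : {x : ∀ t, V.space t | x ∈ (∅ : Set (∀ t, V.space t)) ∧ x t ≠ 0} = ∅ := by
          ext x; simp
        rw [this]
        exact linearIndepOn_empty _ _
      compl := by
        intro t
        simpa using isCompl_bot_top }⟩
  obtain ⟨p, hp⟩ := zorn_le_nonempty (α := PDec V) (PDec.chain_bdd V hfd)
  refine ⟨p.S, p.good, p.indep, fun t => ?_⟩
  have hW : p.W t = ⊥ := by
    by_contra h
    obtain ⟨q, h1, h2⟩ := p.extend hfd t h
    exact h2 (hp h1)
  have := (p.compl t).sup_eq_top
  rwa [hW, sup_bot_eq] at this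

theorem PersIso.symm' {T : Type} [Preorder T] {U V : PersMod k T} (h : PersIso U V) :
    PersIso V U := by
  obtain ⟨e, he⟩ := h
  refine ⟨fun t => (e t).symm, fun s t h => LinearMap.ext fun v => ?_⟩
  obtain ⟨u, rfl⟩ := (e s).surjective v
  have := LinearMap.congr_fun (he s t h) u
  simp only [LinearMap.comp_apply, LinearEquiv.coe_coe] at this ⊢
  rw [← this]
  simp

theorem decomp {T : Type} [LinearOrder T] [Countable T] (V : PersMod k T)
    (hfd : ∀ t, Module.Finite k (V.space t)) :
    ∃ (L : Type) (J : L → Set T) (hJ : ∀ ℓ, IsIntervalSet (J ℓ)),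
      PersIso V (dsum fun ℓ => intervalModule k T (J ℓ) (hJ ℓ)) := by
  obtain ⟨S, hgood, hind, hspan⟩ := exists_basis_family V hfd
  refine ⟨S, fun x => {t | x.1 t ≠ 0}, fun x => (hgood x.1 x.2).interval, PersIso.symm' ?_⟩
  let G : ∀ (t : T) (x : S), (PLift (x.1 t ≠ 0) → k) →ₗ[k] V.space t := fun t x =>
    { toFun := fun f => if h : x.1 t ≠ 0 then f ⟨h⟩ • x.1 t else 0
      map_add' := fun f g => by
        by_cases h : x.1 t ≠ 0
        · simp only [dif_pos h, Pi.add_apply, add_smul]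
        · simp only [dif_neg h, add_zero]
      map_smul' := fun c f => by
        by_cases h : x.1 t ≠ 0
        · simp only [dif_pos h, Pi.smul_apply, smul_assoc, RingHom.id_apply]
        · simp only [dif_neg h, smul_zero] }
  have hG : ∀ t x f (h : x.1 t ≠ 0), G t x f = f ⟨h⟩ • x.1 t := fun t x f h => dif_pos h
  let F : ∀ t, (Π₀ x : S, (PLift (x.1 t ≠ 0) → k)) →ₗ[k] V.space t := fun t =>
    DFinsupp.lsum ℕ (fun x => G t x)
  have hF : ∀ t x f, F t (DFinsupp.single x f) = G t x f := fun t x f => by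
    simp [F]
  have hinj : ∀ t, Function.Injective (F t) := by
    intro t
    rw [injective_iff_map_eq_zero]
    intro f hf
    let c : (∀ t, V.space t) → k := fun x =>
      if h : x ∈ S then if h' : x t ≠ 0 then f ⟨x, h⟩ ⟨h'⟩ else 0 else 0
    have hsum : ∑ x ∈ f.support, G t x (f x) = 0 := by
      refine Eq.trans ?_ hf
      conv_rhs => rw [← DFinsupp.sum_single (f := f)]
      rw [DFinsupp.sum, map_sum]
      exact Finset.sum_congr rfl fun x _ => (hF t x _).symm
    have hsupp : ∀ x ∈ f.support, x.1 t ≠ 0 := by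
      intro x hx h
      refine (DFinsupp.mem_support_iff.1 hx) (funext fun h' => absurd h h'.down)
    have hz := linearIndepOn_iff'.1 (hind t) (f.support.map (Function.Embedding.subtype _)) c
      (by
        intro x hx
        simp only [Finset.coe_map, Set.mem_image, Finset.mem_coe] at hx
        obtain ⟨x, hx, rfl⟩ := hx
        exact ⟨x.2, hsupp x hx⟩)
      (by
        rw [Finset.sum_map]
        refine Eq.trans ?_ hsum
        refine Finset.sum_congr rfl fun x hx => ?_
        have h' := hsupp x hx
        rw [hG t x _ h']
        have : c x.1 = f x ⟨h'⟩ := (dif_pos x.2).trans (dif_pos h')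
        show c x.1 • x.1 t = _
        rw [this])
    refine DFinsupp.ext fun x => ?_
    by_contra hne
    have hx : x ∈ f.support := DFinsupp.mem_support_iff.2 hne
    have h' := hsupp x hx
    have h0 := hz x.1 (Finset.mem_map.2 ⟨x, hx, rfl⟩)
    have hc : c x.1 = f x ⟨h'⟩ := (dif_pos x.2).trans (dif_pos h')
    rw [hc] at h0
    exact hne (funext fun _ => h0)
  have hsurj : ∀ t, Function.Surjective (F t) := by
    intro t
    rw [← LinearMap.range_eq_top, eq_top_iff, ← hspan t, Submodule.span_le]
    rintro _ ⟨x, hx, rfl⟩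
    by_cases h : x t = 0
    · show x t ∈ _
      rw [h]; exact Submodule.zero_mem _
    · refine ⟨DFinsupp.single ⟨x, hx⟩ (fun _ => 1), ?_⟩
      rw [hF, hG t ⟨x, hx⟩ _ h, one_smul]
  refine ⟨fun t => LinearEquiv.ofBijective (F t) ⟨hinj t, hsurj t⟩, fun s t h => ?_⟩
  refine DFinsupp.lhom_ext fun x f => ?_
  show F t (DFinsupp.mapRange.linearMap (fun ℓ : S => (intervalModule k T {t | ℓ.1 t ≠ 0}
    (hgood ℓ.1 ℓ.2).interval).map s t h) (DFinsupp.single x f)) =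
    V.map s t h (F s (DFinsupp.single x f))
  rw [DFinsupp.mapRange.linearMap_apply, DFinsupp.mapRange_single]
  refine (hF t x _).trans ?_
  refine Eq.trans ?_ (congrArg (V.map s t h) (hF s x f)).symm
  by_cases hs : x.1 s ≠ 0
  · rw [hG s x f hs, map_smul, (hgood x.1 x.2).2 s t h hs]
    by_cases ht : x.1 t ≠ 0
    · exact (hG t x _ ht).trans (congrArg (· • x.1 t) (dif_pos hs))
    · refine (dif_neg ht).trans ?_
      rw [not_not.1 ht, smul_zero]
  · have e1 : G s x f = 0 := dif_neg hs
    rw [e1, map_zero]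
    by_cases ht : x.1 t ≠ 0
    · refine (hG t x _ ht).trans ?_
      have : (intervalModule k T {t | x.1 t ≠ 0} (hgood x.1 x.2).interval).map s t h f ⟨ht⟩ = 0 :=
        dif_neg hs
      exact (congrArg (· • x.1 t) this).trans (zero_smul k _)
    · exact dif_neg ht

end Decomposition

theorem stmt2 {k : Type} [Field k] (T : Set ℝ)
    (hT : ∀ x : ℝ, ¬ AccPt x (Filter.principal T)) (V : PersMod k ↥T)
    (hfd : ∀ t, Module.Finite k (V.space t)) :
    ∃ (L : Type) (J : L → Set ↥T) (hJ : ∀ ℓ, IsIntervalSet (J ℓ)),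
      PersIso V (dsum fun ℓ => intervalModule k ↥T (J ℓ) (hJ ℓ)) := by
  haveI : DiscreteTopology T := discreteTopology_of_noAccPts fun x _ => hT x
  haveI : Countable T := TopologicalSpace.separableSpace_iff_countable.1 inferInstance
  exact decomp V hfd
end

section
/- Additivity of the persistence measure: let V be a persistence module over ℝ. For all extended reals −∞ ≤ a and d ≤ +∞ and finite reals p, b, c, q: if a < p < b ≤ c < d then μ_V([a,b]×[c,d]) = μ_V([a,p]×[c,d]) + μ_V([p,b]×[c,d]), and if a < b ≤ c < q < d then μ_V([a,b]×[c,d]) = μ_V([a,b]×[c,q]) + μ_V([a,b]×[q,d]) (sums taken in {0,1,2,…} ∪ {∞}). -/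
attribute [local instance] Classical.propDecidable

open scoped ENNReal

theorem edim_exact {k : Type} [Field k] {X Y Z : Type} [AddCommGroup X] [Module k X]
    [AddCommGroup Y] [Module k Y] [AddCommGroup Z] [Module k Z]
    (i : X →ₗ[k] Y) (g : Y →ₗ[k] Z) (hi : Function.Injective i) (hg : Function.Surjective g)
    (h : LinearMap.range i = LinearMap.ker g) :
    edim k Y = edim k X + edim k Z := by
  unfold edim
  rw [← map_add, LinearMap.rank_eq_of_surjective hg, ← h, ← (LinearEquiv.ofInjective i hi).rank_eq,
    add_comm]

theorem edim_key {k : Type} [Field k] {M N : Type} [AddCommGroup M] [Module k M]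
    [AddCommGroup N] [Module k N] (f : M →ₗ[k] N) (A B A0 B0 : Submodule k M)
    (A' B' : Submodule k N) (hB0 : B0 ≤ B) (hA0 : ∀ x ∈ B0, x ∈ A0 ↔ x ∈ A)
    (hB' : B.map f = B') (hA' : ∀ b ∈ B, f b ∈ A' ↔ b ∈ A ⊔ B0) :
    edim k (↥B ⧸ A.comap B.subtype) =
      edim k (↥B0 ⧸ A0.comap B0.subtype) + edim k (↥B' ⧸ A'.comap B'.subtype) := by
  have hf : ∀ x ∈ B, f x ∈ B' := fun x hx => hB' ▸ Submodule.mem_map_of_mem hx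
  let i := Submodule.mapQ (A0.comap B0.subtype) (A.comap B.subtype) (Submodule.inclusion hB0)
    (fun x hx => (hA0 x.1 x.2).1 hx)
  let g := Submodule.mapQ (A.comap B.subtype) (A'.comap B'.subtype) (f.restrict hf)
    (fun x hx => (hA' x.1 x.2).2 (Submodule.mem_sup_left hx))
  have hi_mk : ∀ x : B0, i (Submodule.Quotient.mk x) =
      Submodule.Quotient.mk (Submodule.inclusion hB0 x) := fun _ => rfl
  have hg_mk : ∀ x : B, g (Submodule.Quotient.mk x) =
      Submodule.Quotient.mk (f.restrict hf x) := fun _ => rfl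
  refine edim_exact i g ?_ ?_ ?_
  · rw [injective_iff_map_eq_zero]
    intro x hx
    induction x using Submodule.Quotient.induction_on with
    | H x =>
      rw [hi_mk, Submodule.Quotient.mk_eq_zero] at hx
      rw [Submodule.Quotient.mk_eq_zero]
      exact (hA0 x.1 x.2).2 hx
  · intro z
    induction z using Submodule.Quotient.induction_on with
    | H z =>
      obtain ⟨z, hz⟩ := z
      have hz' := hz
      rw [← hB'] at hz'
      obtain ⟨b, hb, rfl⟩ := hz'
      exact ⟨Submodule.Quotient.mk ⟨b, hb⟩, rfl⟩
  · apply le_antisymm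
    · rintro _ ⟨x, rfl⟩
      induction x using Submodule.Quotient.induction_on with
      | H x =>
        rw [LinearMap.mem_ker, hi_mk, hg_mk,
          Submodule.Quotient.mk_eq_zero]
        exact (hA' x.1 (hB0 x.2)).2 (Submodule.mem_sup_right x.2)
    · intro y hy
      induction y using Submodule.Quotient.induction_on with
      | H y =>
        rw [LinearMap.mem_ker, hg_mk, Submodule.Quotient.mk_eq_zero] at hy
        obtain ⟨u, hu, w, hw, huw⟩ := Submodule.mem_sup.1 ((hA' y.1 y.2).1 hy)
        refine ⟨Submodule.Quotient.mk ⟨w, hw⟩, ?_⟩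
        rw [hi_mk, eq_comm, Submodule.Quotient.eq]
        show y.1 - w ∈ A
        rw [← huw]
        simpa using hu

theorem persIm_coe {k : Type} [Field k] (V : PersMod k ℝ) (a c : ℝ) (h : a ≤ c) :
    persIm V (a : EReal) c = LinearMap.range (V.map a c h) := by
  have H : ∃ a' : ℝ, (a : EReal) = (a' : EReal) ∧ a' ≤ c := ⟨a, rfl, h⟩
  have key : ∀ (x : ℝ) (hx : x ≤ c), a = x →
      LinearMap.range (V.map x c hx) = LinearMap.range (V.map a c h) := by
    rintro x hx rfl; rfl
  unfold persIm
  rw [dif_pos H]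
  exact key _ _ (EReal.coe_injective H.choose_spec.1)

theorem persIm_bot {k : Type} [Field k] (V : PersMod k ℝ) (c : ℝ) :
    persIm V ⊥ c = ⊥ := by
  unfold persIm
  rw [dif_neg]
  rintro ⟨x, hx, -⟩
  exact EReal.bot_ne_coe x hx

theorem persKer_coe {k : Type} [Field k] (V : PersMod k ℝ) (c d : ℝ) (h : c ≤ d) :
    persKer V c (d : EReal) = LinearMap.ker (V.map c d h) := by
  have H : ∃ d' : ℝ, (d : EReal) = (d' : EReal) ∧ c ≤ d' := ⟨d, rfl, h⟩
  have key : ∀ (x : ℝ) (hx : c ≤ x), d = x →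
      LinearMap.ker (V.map c x hx) = LinearMap.ker (V.map c d h) := by
    rintro x hx rfl; rfl
  unfold persKer
  rw [dif_pos H]
  exact key _ _ (EReal.coe_injective H.choose_spec.1)

theorem persKer_top {k : Type} [Field k] (V : PersMod k ℝ) (c : ℝ) :
    persKer V c ⊤ = ⊤ := by
  unfold persKer
  rw [dif_neg]
  rintro ⟨x, hx, -⟩
  exact EReal.top_ne_coe x hx

theorem persMap_map {k : Type} [Field k] (V : PersMod k ℝ) {r s t : ℝ} (h1 : r ≤ s) (h2 : s ≤ t)
    (x : V.space r) : V.map s t h2 (V.map r s h1 x) = V.map r t (h1.trans h2) x :=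
  LinearMap.congr_fun (V.map_comp r s t h1 h2) x

theorem persIm_mono {k : Type} [Field k] (V : PersMod k ℝ) (a : EReal) (p c : ℝ)
    (h : a < (p : EReal)) (hp : p ≤ c) : persIm V a c ≤ persIm V (p : EReal) c := by
  induction a using EReal.rec with
  | bot => rw [persIm_bot]; exact bot_le
  | top => exact absurd h not_top_lt
  | coe a =>
    have h' : a < p := EReal.coe_lt_coe_iff.1 h
    rw [persIm_coe V a c (h'.le.trans hp), persIm_coe V p c hp]
    rintro _ ⟨x, rfl⟩
    exact ⟨V.map a p h'.le x, persMap_map V _ _ x⟩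

theorem persIm_map {k : Type} [Field k] (V : PersMod k ℝ) (a : EReal) (c q : ℝ)
    (h : a ≤ (c : EReal)) (hq : c ≤ q) :
    (persIm V a c).map (V.map c q hq) = persIm V a q := by
  induction a using EReal.rec with
  | bot => rw [persIm_bot, persIm_bot, Submodule.map_bot]
  | top => exact absurd h (by simp)
  | coe a =>
    have h' : a ≤ c := EReal.coe_le_coe_iff.1 h
    rw [persIm_coe V a c h', persIm_coe V a q (h'.trans hq), ← LinearMap.range_comp, V.map_comp]

theorem persKer_comap {k : Type} [Field k] (V : PersMod k ℝ) (c q : ℝ) (d : EReal)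
    (hq : c ≤ q) (h : (q : EReal) ≤ d) :
    (persKer V q d).comap (V.map c q hq) = persKer V c d := by
  induction d using EReal.rec with
  | top => rw [persKer_top, persKer_top, Submodule.comap_top]
  | bot => exact absurd h (by simp)
  | coe d =>
    have h' : q ≤ d := EReal.coe_le_coe_iff.1 h
    rw [persKer_coe V q d h', persKer_coe V c d (hq.trans h'), ← LinearMap.ker_comp, V.map_comp]

theorem stmt8 {k : Type} [Field k] (V : PersMod k ℝ) (a : EReal) (d : EReal) :
    (∀ p b c : ℝ, a < (p : EReal) → p < b → b ≤ c → (c : EReal) < d →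
      persMeasure V a b c d = persMeasure V a p c d + persMeasure V (p : EReal) b c d) ∧
    (∀ b c q : ℝ, a < (b : EReal) → b ≤ c → c < q → (q : EReal) < d →
      persMeasure V a b c d = persMeasure V a b c (q : EReal) + persMeasure V a b q d) := by
  refine ⟨fun p b c hap hpb hbc hcd => ?_, fun b c q hab hbc hcq hqd => ?_⟩
  · have h1 := persIm_mono V a p c hap (hpb.le.trans hbc)
    have h2 := persIm_mono V (p : EReal) b c (EReal.coe_lt_coe_iff.2 hpb) hbc
    refine edim_key LinearMap.id _ _ _ _ _ _ (inf_le_inf_right _ h2) (fun _ _ => Iff.rfl)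
      (Submodule.map_id _) (fun x _ => ?_)
    rw [sup_eq_right.2 (inf_le_inf_right _ h1)]
    rfl
  · have hab' := persIm_mono V a b c hab hbc
    have hac : a ≤ (c : EReal) := hab.le.trans (EReal.coe_le_coe_iff.2 hbc)
    have hk := persKer_comap V c q d hcq.le hqd.le
    have hkq := persKer_coe V c q hcq.le
    have hle : persKer V c (q : EReal) ≤ persKer V c d := by
      rw [hkq, ← hk]
      exact Submodule.comap_mono bot_le
    have himg : ∀ e : EReal, e ≤ (c : EReal) →
        (persIm V e c ⊓ persKer V c d).map (V.map c q hcq.le) =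
          persIm V e q ⊓ persKer V q d := by
      intro e he
      rw [← hk, ← persIm_map V e c q he hcq.le, ← Submodule.map_inf_eq_map_inf_comap]
    refine edim_key (V.map c q hcq.le) _ _ _ _ _ _ (inf_le_inf_left _ hle) ?_
      (himg b (EReal.coe_le_coe_iff.2 hbc)) ?_
    · rintro x ⟨_, hx⟩
      exact ⟨fun h => ⟨h.1, hle h.2⟩, fun h => ⟨h.1, hx⟩⟩
    · intro x hx
      rw [← himg a hac]
      constructor
      · rintro ⟨u, hu, hux⟩
        have hxu : x - u ∈ persKer V c (q : EReal) := by
          rw [hkq, LinearMap.mem_ker, map_sub, hux, sub_self]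
        exact Submodule.mem_sup.2 ⟨u, hu, x - u,
          ⟨sub_mem hx.1 (hab' hu.1), hxu⟩, by abel⟩
      · intro h
        obtain ⟨u, hu, w, hw, rfl⟩ := Submodule.mem_sup.1 h
        refine ⟨u, hu, ?_⟩
        have hw2 := hw.2
        rw [hkq] at hw2
        rw [map_add, LinearMap.mem_ker.1 hw2, add_zero]
end
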